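/- arXiv:1711.05437 — 2 statements merged into one kernel-verified Lean document; each statement's English description precedes it below -/
import Mathlib

section
/- Assume G ≅ C_{n1} ⊕ … ⊕ C_{nr} with 1 < n1 | … | nr and D(G) ≥ 4, and suppose r ≥ ⌊nr/2⌋ + 1. Let d ∈ Δ1(G) with ⌊nr/2⌋ ≤ d ≤ r − 1, and let G0 ⊆ G be a subset with d | min Δ(G0). If A ∈ A(G0) satisfies k(A) > 1, then k(A) = 1 + s·d/n_{r−d} for some s ∈ ℕ. -/
/- Common definitions: zero-sum sequences over a finite abelian group,
   sets of lengths, the system of sets of lengths, the Davenport constant,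
   sets of distances, elasticities, AAPs, Δ₁(G), ρ(G,d,k), ρ(G,d), ρ*(G,d),
   cross numbers, K(G₀), K(G,d), LCN-sets, Δ*(G). -/

open scoped Classical

section Defs

variable {G : Type*} [AddCommGroup G]

/-- The support of a sequence (multiset) over `G`. -/
def suppSet (A : Multiset G) : Set G := {g | g ∈ A}

/-- `A` is a minimal zero-sum sequence (an atom of `𝓑(G₀)`) over `G₀ ⊆ G`:
a nontrivial zero-sum sequence with terms in `G₀` such that every proper
nontrivial subsequence has nonzero sum. -/
def IsMinZeroSum (G0 : Set G) (A : Multiset G) : Prop :=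
  A ≠ 0 ∧ (∀ g ∈ A, g ∈ G0) ∧ A.sum = 0 ∧
    ∀ T : Multiset G, T ≤ A → T.sum = 0 → T = 0 ∨ T = A

/-- `B` is a zero-sum sequence over `G₀ ⊆ G` (an element of `𝓑(G₀)`). -/
def IsZeroSumSeq (G0 : Set G) (B : Multiset G) : Prop :=
  (∀ g ∈ B, g ∈ G0) ∧ B.sum = 0

/-- The set of lengths `L(B)` of a zero-sum sequence `B` over `G₀`:
all `k` such that `B` is a product of `k` atoms of `𝓑(G₀)`.
(For the trivial sequence this is `{0}`.) -/
def lengthSet (G0 : Set G) (B : Multiset G) : Set ℕ :=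
  {k | ∃ U : Fin k → Multiset G, (∀ i, IsMinZeroSum G0 (U i)) ∧ B = ∑ i, U i}

/-- The system of sets of lengths `𝓛(G₀)`. -/
def systemL (G0 : Set G) : Set (Set ℕ) :=
  {L | ∃ B : Multiset G, IsZeroSumSeq G0 B ∧ L = lengthSet G0 B}

/-- The Davenport constant `D(G)`: the maximal length of a minimal zero-sum
sequence over `G`. -/
noncomputable def davenport (G : Type*) [AddCommGroup G] : ℕ :=
  sSup {m | ∃ A : Multiset G, IsMinZeroSum (Set.univ : Set G) A ∧ Multiset.card A = m}

/-- The set of successive distances `Δ(L)` of a set `L ⊆ ℕ`. -/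
def deltaOf (L : Set ℕ) : Set ℕ :=
  {d | 0 < d ∧ ∃ a, a ∈ L ∧ a + d ∈ L ∧ ∀ c ∈ L, ¬(a < c ∧ c < a + d)}

/-- `Δ(G₀) = ⋃_{L ∈ 𝓛(G₀)} Δ(L)`. -/
def deltaG0 (G0 : Set G) : Set ℕ := ⋃ L ∈ systemL G0, deltaOf L

/-- `Δ*(G) = {min Δ(G₀) : G₀ ⊆ G with Δ(G₀) ≠ ∅}`. -/
def deltaStar (G : Type*) [AddCommGroup G] : Set ℕ :=
  {d | ∃ G0 : Set G, deltaG0 G0 ≠ ∅ ∧ d = sInf (deltaG0 G0)}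

/-- The elasticity `ρ(L) = max L / min L` of a (finite) set `L ⊆ ℕ`,
with the convention `ρ({0}) = 1`. -/
noncomputable def rhoL (L : Set ℕ) : ℝ :=
  if sInf L = 0 then 1 else ((sSup L : ℕ) : ℝ) / ((sInf L : ℕ) : ℝ)

/-- The elasticity `ρ(G₀) = sup {ρ(L) : L ∈ 𝓛(G₀)}`. -/
noncomputable def rhoG0 (G0 : Set G) : ℝ := sSup (rhoL '' systemL G0)

/-- `L` (a set of naturals) is an almost arithmetical progression (AAP)
with difference `d`, length `ℓ` and bound `M`:
`L = y + (L' ∪ {0, d, …, ℓd} ∪ L'') ⊆ y + dℤ` with `L' ⊆ [−M, −1]` and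
`L'' ⊆ ℓd + [1, M]`. -/
def IsAAP (L : Set ℕ) (d ℓ M : ℕ) : Prop :=
  ∃ (y : ℤ) (L1 L2 : Set ℤ),
    L1 ⊆ Set.Icc (-(M : ℤ)) (-1) ∧
    L2 ⊆ Set.Icc ((ℓ : ℤ) * d + 1) ((ℓ : ℤ) * d + M) ∧
    ((fun x : ℕ => (x : ℤ)) '' L) =
      (fun x => y + x) '' (L1 ∪ (fun i : ℤ => (d : ℤ) * i) '' Set.Icc (0 : ℤ) (ℓ : ℤ) ∪ L2) ∧
    (∀ x ∈ L, (d : ℤ) ∣ ((x : ℤ) - y))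

/-- `Δ₁(G)`: the set of `d ∈ ℕ` such that for every `k` there is some
`L ∈ 𝓛(G)` which is an AAP with difference `d` and length at least `k`. -/
def delta1 (G : Type*) [AddCommGroup G] : Set ℕ :=
  {d | 0 < d ∧ ∀ k : ℕ, ∃ L ∈ systemL (Set.univ : Set G), ∃ ℓ ≥ k, ∃ M : ℕ, IsAAP L d ℓ M}

/-- `ρ(G, d, k)`: the supremum of elasticities of sets of lengths of `G` which
are AAPs with difference `d` and length at least `k`. -/
noncomputable def rhoGdk (G : Type*) [AddCommGroup G] (d k : ℕ) : ℝ :=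
  sSup (rhoL '' {L | L ∈ systemL (Set.univ : Set G) ∧ ∃ ℓ ≥ k, ∃ M : ℕ, IsAAP L d ℓ M})

/-- `ρ(G, d)`: the limit of the decreasing sequence `(ρ(G, d, k))_k`,
i.e. its infimum. -/
noncomputable def rhoGd (G : Type*) [AddCommGroup G] (d : ℕ) : ℝ :=
  ⨅ k : ℕ, rhoGdk G d k

/-- `ρ*(G, d) = max {ρ(G₀) : G₀ ⊆ G non-half-factorial with d ∣ min Δ(G₀)}`. -/
noncomputable def rhoStar (G : Type*) [AddCommGroup G] (d : ℕ) : ℝ :=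
  sSup {x | ∃ G0 : Set G, deltaG0 G0 ≠ ∅ ∧ d ∣ sInf (deltaG0 G0) ∧ x = rhoG0 G0}

/-- The cross number `k(S) = Σ_{g ∈ S} 1/ord(g)` of a sequence `S`. -/
noncomputable def crossNum (S : Multiset G) : ℝ :=
  (S.map (fun g => (1 : ℝ) / (addOrderOf g))).sum

/-- `K(G₀) = max {k(A) : A ∈ 𝓐(G₀)}`, the cross number of `G₀`. -/
noncomputable def KG0 (G0 : Set G) : ℝ :=
  sSup {x | ∃ A : Multiset G, IsMinZeroSum G0 A ∧ x = crossNum A}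

/-- `K(G, d) = max {K(G₀) : G₀ ⊆ G non-half-factorial with d ∣ min Δ(G₀)}`. -/
noncomputable def KGd (G : Type*) [AddCommGroup G] (d : ℕ) : ℝ :=
  sSup {x | ∃ G0 : Set G, deltaG0 G0 ≠ ∅ ∧ d ∣ sInf (deltaG0 G0) ∧ x = KG0 G0}

/-- `G₀` is an LCN-set: `k(A) ≥ 1` for every atom `A` of `𝓑(G₀)`. -/
def IsLCN (G0 : Set G) : Prop :=
  ∀ A : Multiset G, IsMinZeroSum G0 A → 1 ≤ crossNum A

end Defs

section Aux

variable {G : Type*} [AddCommGroup G]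

/-- Factorization of `B` into `l` atoms over `G0`. -/
def FacLen (G0 : Set G) (B : Multiset G) (l : ℕ) : Prop :=
  ∃ s : Multiset (Multiset G), (∀ U ∈ s, IsMinZeroSum G0 U) ∧ s.sum = B ∧ Multiset.card s = l

theorem facLen_mem {G0 : Set G} {B : Multiset G} {l : ℕ} (h : FacLen G0 B l) :
    l ∈ lengthSet G0 B := by
  obtain ⟨s, h1, h2, h3⟩ := h
  induction s using Quotient.inductionOn with
  | h L =>
    subst h3
    refine ⟨fun i : Fin L.length => L.get i, fun i => h1 _ (List.get_mem L i), ?_⟩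
    rw [← h2]
    change L.sum = ∑ i : Fin L.length, L.get i
    rw [← List.sum_ofFn, List.ofFn_get]

theorem facLen_of_mem {G0 : Set G} {B : Multiset G} {l : ℕ} (h : l ∈ lengthSet G0 B) :
    FacLen G0 B l := by
  obtain ⟨U, hU, hB⟩ := h
  refine ⟨(List.ofFn U : Multiset (Multiset G)), ?_, ?_, by simp⟩
  · intro V hV
    simp only [Multiset.mem_coe, List.mem_ofFn] at hV
    obtain ⟨i, rfl⟩ := hV
    exact hU i
  · rw [hB]
    simp [List.sum_ofFn]

theorem FacLen.add {G0 : Set G} {B C : Multiset G} {l m : ℕ} (h : FacLen G0 B l)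
    (h' : FacLen G0 C m) : FacLen G0 (B + C) (l + m) := by
  obtain ⟨s, h1, h2, h3⟩ := h
  obtain ⟨t, k1, k2, k3⟩ := h'
  refine ⟨s + t, ?_, by simp [h2, k2], by simp [h3, k3]⟩
  intro U hU
  rcases Multiset.mem_add.1 hU with h | h
  · exact h1 U h
  · exact k1 U h

theorem FacLen.zero (G0 : Set G) : FacLen G0 (0 : Multiset G) 0 := ⟨0, by simp, by simp, by simp⟩

theorem FacLen.atom {G0 : Set G} {A : Multiset G} (h : IsMinZeroSum G0 A) : FacLen G0 A 1 :=
  ⟨{A}, by simpa using h, by simp, by simp⟩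

theorem FacLen.nsmul {G0 : Set G} {B : Multiset G} {l : ℕ} (h : FacLen G0 B l) (k : ℕ) :
    FacLen G0 (k • B) (k * l) := by
  induction k with
  | zero => simpa using FacLen.zero G0
  | succ k ih => rw [succ_nsmul, Nat.succ_mul]; exact ih.add h

theorem FacLen.sum {ι : Type*} {G0 : Set G} (F : Finset ι) (B : ι → Multiset G) (l : ι → ℕ)
    (h : ∀ i ∈ F, FacLen G0 (B i) (l i)) : FacLen G0 (∑ i ∈ F, B i) (∑ i ∈ F, l i) := by
  classical
  induction F using Finset.induction_on with
  | empty => simpa using FacLen.zero G0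
  | insert a F ha ih =>
    rw [Finset.sum_insert ha, Finset.sum_insert ha]
    exact (h a (by simp)).add (ih fun i hi => h i (by simp [hi]))

theorem FacLen.isZeroSum {G0 : Set G} {B : Multiset G} {l : ℕ} (h : FacLen G0 B l) :
    IsZeroSumSeq G0 B := by
  obtain ⟨s, h1, h2, h3⟩ := h
  subst h2
  clear h3
  induction s using Multiset.induction_on with
  | empty => exact ⟨by simp, by simp⟩
  | cons U s ih =>
    have hU := h1 U (by simp)
    have hs := ih fun V hV => h1 V (by simp [hV])
    refine ⟨?_, ?_⟩
    · intro g hg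
      rw [Multiset.sum_cons, Multiset.mem_add] at hg
      rcases hg with h | h
      · exact hU.2.1 g h
      · exact hs.1 g h
    · rw [Multiset.sum_cons, Multiset.sum_add, hU.2.2.1, hs.2, add_zero]

theorem exists_facLen (G0 : Set G) (B : Multiset G) (hB : ∀ g ∈ B, g ∈ G0) (h0 : B.sum = 0) :
    ∃ l, FacLen G0 B l := by
  induction hc : Multiset.card B using Nat.strong_induction_on generalizing B with
  | _ k ih =>
    by_cases hz : B = 0
    · exact ⟨0, hz ▸ FacLen.zero G0⟩
    by_cases hm : IsMinZeroSum G0 B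
    · exact ⟨1, FacLen.atom hm⟩
    have : ∃ T : Multiset G, T ≤ B ∧ T.sum = 0 ∧ T ≠ 0 ∧ T ≠ B := by
      by_contra hcon
      push Not at hcon
      refine hm ⟨hz, hB, h0, fun T hT hs => ?_⟩
      by_cases hT0 : T = 0
      · exact Or.inl hT0
      · exact Or.inr (hcon T hT hs hT0)
    obtain ⟨T, hT, hs, hT0, hTB⟩ := this
    obtain ⟨R, rfl⟩ := Multiset.le_iff_exists_add.1 hT
    have hR0 : R ≠ 0 := by rintro rfl; simp at hTB
    have c1 := Multiset.card_pos.2 hT0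
    have c2 := Multiset.card_pos.2 hR0
    rw [Multiset.card_add] at hc
    have hRs : R.sum = 0 := by simpa [hs] using h0
    obtain ⟨l1, h1⟩ := ih _ (by omega) T (fun g hg => hB g (by simp [hg])) hs rfl
    obtain ⟨l2, h2⟩ := ih _ (by omega) R (fun g hg => hB g (by simp [hg])) hRs rfl
    exact ⟨_, h1.add h2⟩

theorem exists_delta_le {L : Set ℕ} {x y : ℕ} (hx : x ∈ L) (hy : y ∈ L) (hxy : x < y) :
    ∃ δ ∈ deltaOf L, δ ≤ y - x := by
  have hex : ∃ z, z ∈ L ∧ x < z := ⟨y, hy, hxy⟩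
  have h1 := Nat.find_spec hex
  have h2 : Nat.find hex ≤ y := Nat.find_min' hex ⟨hy, hxy⟩
  refine ⟨Nat.find hex - x, ⟨by omega, x, hx, ?_, ?_⟩, by omega⟩
  · rw [Nat.add_sub_cancel' h1.2.le]; exact h1.1
  · rintro c hc ⟨h3, h4⟩
    have := Nat.find_min' hex ⟨hc, h3⟩
    omega

theorem exists_deltaG0_le {G0 : Set G} {B : Multiset G} {x y : ℕ} (hx : FacLen G0 B x)
    (hy : FacLen G0 B y) (hxy : x < y) : ∃ δ ∈ deltaG0 G0, δ ≤ y - x := by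
  obtain ⟨δ, h1, h2⟩ := exists_delta_le (facLen_mem hx) (facLen_mem hy) hxy
  exact ⟨δ, Set.mem_iUnion₂.2 ⟨_, ⟨B, hx.isZeroSum, rfl⟩, h1⟩, h2⟩

theorem sInf_dvd_aux {G0 : Set G} {B : Multiset G} {x y : ℕ} (hx : FacLen G0 B x)
    (hy : FacLen G0 B y) (hxy : x < y) : sInf (deltaG0 G0) ∣ y - x := by
  obtain ⟨δ, hδ, -⟩ := exists_deltaG0_le hx hy hxy
  have hmem := Nat.sInf_mem ⟨δ, hδ⟩
  set m := sInf (deltaG0 G0) with hm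
  obtain ⟨L, ⟨C, hC, rfl⟩, hmpos, a, ha, ha', -⟩ := Set.mem_iUnion₂.1 hmem
  by_contra hnd
  have hr : 0 < (y - x) % m := Nat.pos_of_ne_zero fun h => hnd (Nat.dvd_of_mod_eq_zero h)
  have hlt : (y - x) % m < m := Nat.mod_lt _ hmpos
  have hdm := Nat.div_add_mod (y - x) m
  set t := (y - x) / m
  have f1 := ((facLen_of_mem ha').nsmul t).add hx
  have f2 := ((facLen_of_mem ha).nsmul t).add hy
  have e1 : t * (a + m) = t * a + m * t := by ring
  obtain ⟨δ', h1, h2⟩ := exists_deltaG0_le f1 f2 (by omega)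
  have := Nat.sInf_le h1
  omega

theorem dvd_sub_of_facLen {G0 : Set G} {d : ℕ} (hd : d ∣ sInf (deltaG0 G0))
    {B : Multiset G} {x y : ℕ} (hx : FacLen G0 B x)
    (hy : FacLen G0 B y) : (d : ℤ) ∣ (y : ℤ) - x := by
  rcases lt_trichotomy x y with h | h | h
  · have := hd.trans (sInf_dvd_aux hx hy h)
    have h2 := Int.natCast_dvd_natCast.2 this
    rwa [Nat.cast_sub h.le] at h2
  · simp [h]
  · have := hd.trans (sInf_dvd_aux hy hx h)
    have h2 := Int.natCast_dvd_natCast.2 this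
    rw [Nat.cast_sub h.le] at h2
    rw [← neg_sub]
    exact (dvd_neg).2 h2

/-- `e` times the cross number. -/
noncomputable def kN (e : ℕ) (S : Multiset G) : ℕ := (S.map fun g => e / addOrderOf g).sum

theorem kN_add (e : ℕ) (S T : Multiset G) : kN e (S + T) = kN e S + kN e T := by
  simp [kN]

theorem kN_nsmul (e k : ℕ) (S : Multiset G) : kN e (k • S) = k * kN e S := by
  simp [kN, Multiset.map_nsmul, Multiset.sum_nsmul]

theorem kN_sum {ι : Type*} (e : ℕ) (F : Finset ι) (B : ι → Multiset G) :
    kN e (∑ i ∈ F, B i) = ∑ i ∈ F, kN e (B i) := by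
  classical
  induction F using Finset.induction_on with
  | empty => simp [kN]
  | insert a F ha ih => rw [Finset.sum_insert ha, Finset.sum_insert ha, kN_add, ih]

theorem kN_replicate (e : ℕ) (he : ∀ g : G, addOrderOf g ∣ e) (g : G) :
    kN e (Multiset.replicate (addOrderOf g) g) = e := by
  simp [kN, Nat.mul_div_cancel' (he g)]

theorem crossNum_eq (e : ℕ) (he0 : 0 < e) (he : ∀ g : G, addOrderOf g ∣ e) (S : Multiset G) :
    (kN e S : ℝ) = e * crossNum S := by
  unfold kN crossNum
  induction S using Multiset.induction_on with
  | empty => simp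
  | cons g S ih =>
    have hpos : (addOrderOf g : ℝ) ≠ 0 := by
      have := Nat.pos_of_dvd_of_pos (he g) he0
      positivity
    simp only [Multiset.map_cons, Multiset.sum_cons, Nat.cast_add, ih, mul_add]
    rw [Nat.cast_div (he g) hpos]
    ring

theorem kN_ge_of_fac {G0 : Set G} {B : Multiset G} {l e c : ℕ} {P : Set G} (h : FacLen G0 B l)
    (hB : ∀ g ∈ B, g ∈ P)
    (hP : ∀ U, IsMinZeroSum G0 U → (∀ g ∈ U, g ∈ P) → c ≤ kN e U) : l * c ≤ kN e B := by
  obtain ⟨s, h1, h2, h3⟩ := h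
  subst h2 h3
  induction s using Multiset.induction_on with
  | empty => simp
  | cons U s ih =>
    rw [Multiset.sum_cons] at hB
    rw [Multiset.sum_cons, Multiset.card_cons, kN_add, Nat.succ_mul]
    have a1 := hP U (h1 U (by simp)) fun g hg => hB g (by simp [hg])
    have a2 := ih (fun V hV => h1 V (by simp [hV])) fun g hg => hB g (by
      rw [Multiset.mem_add]; exact Or.inr hg)
    omega

theorem kN_le_of_fac {G0 : Set G} {B : Multiset G} {l e c : ℕ} {P : Set G} (h : FacLen G0 B l)
    (hB : ∀ g ∈ B, g ∈ P)
    (hP : ∀ U, IsMinZeroSum G0 U → (∀ g ∈ U, g ∈ P) → kN e U ≤ c) : kN e B ≤ l * c := by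
  obtain ⟨s, h1, h2, h3⟩ := h
  subst h2 h3
  induction s using Multiset.induction_on with
  | empty => simp [kN]
  | cons U s ih =>
    rw [Multiset.sum_cons] at hB
    rw [Multiset.sum_cons, Multiset.card_cons, kN_add, Nat.succ_mul]
    have a1 := hP U (h1 U (by simp)) fun g hg => hB g (by simp [hg])
    have a2 := ih (fun V hV => h1 V (by simp [hV])) fun g hg => hB g (by
      rw [Multiset.mem_add]; exact Or.inr hg)
    omega

theorem atom_replicate {G0 : Set G} {g : G} (hg : g ∈ G0) (hpos : 0 < addOrderOf g) :
    IsMinZeroSum G0 (Multiset.replicate (addOrderOf g) g) := by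
  refine ⟨?_, ?_, ?_, ?_⟩
  · intro h
    have := congrArg Multiset.card h
    rw [Multiset.card_replicate, Multiset.card_zero] at this
    omega
  · intro x hx
    rw [Multiset.eq_of_mem_replicate hx]; exact hg
  · simp [addOrderOf_nsmul_eq_zero]
  · intro T hT hs
    obtain ⟨j, hj, rfl⟩ := Multiset.le_replicate_iff.1 hT
    rw [Multiset.sum_replicate] at hs
    have hdv := addOrderOf_dvd_of_nsmul_eq_zero hs
    rcases Nat.eq_zero_or_pos j with h | h
    · left; simp [h]
    · right
      have := Nat.le_of_dvd h hdv
      rw [le_antisymm hj this]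

theorem count_lt_of_atom {G0 : Set G} {U : Multiset G} {e : ℕ} (he0 : 0 < e)
    (he : ∀ g : G, addOrderOf g ∣ e) (hU : IsMinZeroSum G0 U) (hne : kN e U ≠ e) (g : G) :
    U.count g < addOrderOf g := by
  by_contra hcon
  push Not at hcon
  have hle := Multiset.le_count_iff_replicate_le.1 hcon
  have hpos := Nat.pos_of_dvd_of_pos (he g) he0
  rcases hU.2.2.2 _ hle (by simp [addOrderOf_nsmul_eq_zero]) with h | h
  · have := congrArg Multiset.card h
    rw [Multiset.card_replicate, Multiset.card_zero] at this
    omega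
  · apply hne
    rw [← h, kN_replicate e he]

/-- `supp A` is an LCN-set. -/
theorem lcn_supp {G0 : Set G} {A : Multiset G} {e d : ℕ} (he0 : 0 < e)
    (he : ∀ g : G, addOrderOf g ∣ e) (hed : e ≤ 2 * d + 1)
    (hd : d ∣ sInf (deltaG0 G0)) (hA : IsMinZeroSum G0 A) (hk : e < kN e A) :
    ∀ U, IsMinZeroSum G0 U → (∀ g ∈ U, g ∈ A) → e ≤ kN e U := by
  by_contra hcon
  push Not at hcon
  obtain ⟨U0, hU0, hU0A, hlt0⟩ := hcon
  have hex : ∃ c, ∃ U, IsMinZeroSum G0 U ∧ (∀ g ∈ U, g ∈ A) ∧ kN e U = c := ⟨_, U0, hU0, hU0A, rfl⟩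
  obtain ⟨U, hU, hUA, hc⟩ := Nat.find_spec hex
  have hmin : ∀ V, IsMinZeroSum G0 V → (∀ g ∈ V, g ∈ A) → kN e U ≤ kN e V := by
    intro V hV hVA
    rw [hc]
    exact Nat.find_min' hex ⟨V, hV, hVA, rfl⟩
  have hlt : kN e U < e := (hmin U0 hU0 hU0A).trans_lt hlt0
  have hnd : U.Nodup := by
    rw [Multiset.nodup_iff_count_le_one]
    intro g
    by_contra hv
    push Not at hv
    have hord := count_lt_of_atom he0 he hU hlt.ne g
    set v := U.count g with hvdef
    set o := addOrderOf g with ho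
    have hoe : o ≤ e := Nat.le_of_dvd he0 (he g)
    have hex2 : ∃ j, o ≤ j * v := ⟨o, Nat.le_mul_of_pos_right _ (by omega)⟩
    have hj1 := Nat.find_spec hex2
    have hj2 : ∀ i, i < Nat.find hex2 → i * v < o := fun i hi => not_le.1 (Nat.find_min hex2 hi)
    set j := Nat.find hex2 with hj
    have hle : Multiset.replicate o g ≤ j • U := by
      rw [← Multiset.le_count_iff_replicate_le, Multiset.count_nsmul]
      exact hj1
    obtain ⟨W, hW⟩ := Multiset.le_iff_exists_add.1 hle
    have hgU : g ∈ U := Multiset.count_pos.1 (by omega)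
    have hWU : ∀ x ∈ W, x ∈ U := by
      intro x hx
      have : x ∈ j • U := by rw [hW]; simp [hx]
      exact Multiset.mem_of_mem_nsmul this
    have hWs : W.sum = 0 := by
      have := congrArg Multiset.sum hW
      rw [Multiset.sum_nsmul, hU.2.2.1, Multiset.sum_add, Multiset.sum_replicate, ho,
        addOrderOf_nsmul_eq_zero] at this
      simpa using this.symm
    obtain ⟨l, hl⟩ := exists_facLen G0 W (fun x hx => hU.2.1 x (hWU x hx)) hWs
    have hkW := congrArg (kN e) hW
    rw [kN_nsmul, kN_add, ho, kN_replicate e he] at hkW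
    have hlk : l * kN e U ≤ kN e W :=
      kN_ge_of_fac (P := {x | x ∈ A}) hl (fun x hx => hUA x (hWU x hx)) hmin
    have hlj : l + 1 < j := by
      by_contra hcc
      push Not at hcc
      have : j * kN e U ≤ (l + 1) * kN e U := Nat.mul_le_mul_right _ hcc
      rw [Nat.succ_mul] at this
      omega
    have f1 : FacLen G0 (j • U) (1 + l) := by
      rw [hW]
      exact (FacLen.atom (atom_replicate (hU.2.1 g hgU) (Nat.pos_of_dvd_of_pos (he g) he0))).add hl
    have f2 : FacLen G0 (j • U) (j * 1) := (FacLen.atom hU).nsmul j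
    have hdv := dvd_sub_of_facLen hd f1 f2
    have hdle := Int.le_of_dvd (by push_cast; omega) hdv
    have hl1 : l ≠ 0 := by
      rintro rfl
      obtain ⟨s, -, h2, h3⟩ := hl
      have hW0 : W = 0 := by rw [← h2, Multiset.card_eq_zero.1 h3]; simp
      rw [hW0, add_zero] at hW
      have hUg : ∀ x ∈ U, x = g := by
        intro x hx
        have : x ∈ j • U := by
          rw [Multiset.mem_nsmul]; exact ⟨by omega, hx⟩
        rw [hW] at this
        exact Multiset.eq_of_mem_replicate this
      have hUr : U = Multiset.replicate (Multiset.card U) g := Multiset.eq_replicate_card.2 hUg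
      have hcv : Multiset.card U = v := by
        rw [hvdef]
        conv_rhs => rw [hUr]
        simp
      have hs := hU.2.2.1
      rw [hUr, Multiset.sum_replicate, hcv] at hs
      have := Nat.le_of_dvd (by omega) (addOrderOf_dvd_of_nsmul_eq_zero hs)
      omega
    have hjd : d + 2 ≤ j := by push_cast at hdle; omega
    have := hj2 (d + 1) (by omega)
    have : (d + 1) * 2 ≤ (d + 1) * v := Nat.mul_le_mul_left _ hv
    omega
  have hUleA : U ≤ A := (Multiset.le_iff_subset hnd).2 hUA
  rcases hA.2.2.2 U hUleA hU.2.2.1 with h | h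
  · exact hU.1 h
  · rw [h] at hlt; omega

theorem small_atom {G0 : Set G} {A : Multiset G} {e d : ℕ} (he0 : 0 < e)
    (he : ∀ g : G, addOrderOf g ∣ e)
    (hd : d ∣ sInf (deltaG0 G0))
    (hlcn : ∀ U, IsMinZeroSum G0 U → (∀ g ∈ U, g ∈ A) → e ≤ kN e U)
    (F : Finset G) (hFA : ∀ g ∈ F, g ∈ A) (hF : F.card ≤ d + 1)
    (U : Multiset G) (hU : IsMinZeroSum G0 U) (hUF : ∀ g ∈ U, g ∈ F) : kN e U ≤ e := by
  by_contra hcon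
  push Not at hcon
  have hcnt := count_lt_of_atom he0 he hU hcon.ne'
  set E := U.toFinset with hE
  have hEF : E ⊆ F := fun x hx => hUF x (Multiset.mem_toFinset.1 hx)
  have hEc := Finset.card_le_card hEF
  set V : Multiset G := ∑ g ∈ E, Multiset.replicate (addOrderOf g - U.count g) g with hV
  have hUE : U = ∑ g ∈ E, Multiset.replicate (U.count g) g := by
    conv_lhs => rw [← Multiset.toFinset_sum_count_nsmul_eq U]
    simp [Multiset.nsmul_singleton, hE]
  have hUV : U + V = ∑ g ∈ E, Multiset.replicate (addOrderOf g) g := by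
    conv_lhs => rw [hUE]
    rw [hV, ← Finset.sum_add_distrib]
    refine Finset.sum_congr rfl fun g _ => ?_
    rw [← Multiset.replicate_add, Nat.add_sub_cancel' (hcnt g).le]
  have hVE : ∀ x ∈ V, x ∈ E := by
    intro x hx
    rw [hV, Multiset.mem_sum] at hx
    obtain ⟨g, hg, hx⟩ := hx
    rw [Multiset.eq_of_mem_replicate hx]; exact hg
  have hEU : ∀ x ∈ E, x ∈ U := fun x hx => Multiset.mem_toFinset.1 hx
  have f1 : FacLen G0 (U + V) (∑ g ∈ E, 1) := by
    rw [hUV]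
    exact FacLen.sum E _ _ fun g hg => FacLen.atom
      (atom_replicate (hU.2.1 g (hEU g hg)) (Nat.pos_of_dvd_of_pos (he g) he0))
  have hVs : V.sum = 0 := by
    have := f1.isZeroSum.2
    rwa [Multiset.sum_add, hU.2.2.1, zero_add] at this
  obtain ⟨l, hl⟩ := exists_facLen G0 V (fun x hx => hU.2.1 x (hEU x (hVE x hx))) hVs
  have hlk : l * e ≤ kN e V :=
    kN_ge_of_fac (P := {x | x ∈ A}) hl (fun x hx => hFA x (hEF (hVE x hx))) hlcn
  have hkk := congrArg (kN e) hUV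
  rw [kN_add, kN_sum e E (fun g => Multiset.replicate (addOrderOf g) g),
    Finset.sum_congr rfl fun g _ => kN_replicate e he g] at hkk
  rw [Finset.sum_const, smul_eq_mul] at hkk
  have f2 := (FacLen.atom hU).add hl
  have hlm : l + 1 < E.card := by
    by_contra hcc
    push Not at hcc
    have : E.card * e ≤ (l + 1) * e := Nat.mul_le_mul_right _ hcc
    rw [Nat.succ_mul] at this
    omega
  have hdv := dvd_sub_of_facLen hd f2 f1
  have hdle := Int.le_of_dvd (by simp; omega) hdv
  have hl1 : l ≠ 0 := by
    rintro rfl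
    obtain ⟨s, -, h2, h3⟩ := hl
    have hV0 : V = 0 := by rw [← h2, Multiset.card_eq_zero.1 h3]; simp
    obtain ⟨g, hg⟩ := Multiset.exists_mem_of_ne_zero hU.1
    have : g ∈ V := by
      rw [hV, Multiset.mem_sum]
      refine ⟨g, Multiset.mem_toFinset.2 hg, ?_⟩
      rw [Multiset.mem_replicate]
      have := hcnt g
      exact ⟨by omega, rfl⟩
    rw [hV0] at this
    simp at this
  simp at hdle
  omega

end Aux

section Aux2

theorem sum_insert_coeff {ι : Type*} (T : Finset ι) (t0 : ι) (c : ι → ℤ) (k : ℤ) :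
    ∃ c' : ι → ℤ, ∀ f : ι → ℤ, ∑ t ∈ insert t0 T, c' t * f t = ∑ t ∈ T, c t * f t + k * f t0 := by
  refine ⟨fun t => (if t ∈ T then c t else 0) + (if t = t0 then k else 0), fun f => ?_⟩
  simp only [add_mul, Finset.sum_add_distrib, ite_mul, zero_mul]
  congr 1
  · rw [← Finset.sum_filter]
    refine Finset.sum_congr ?_ fun _ _ => rfl
    ext x
    simp only [Finset.mem_filter, Finset.mem_insert]
    tauto
  · rw [Finset.sum_ite_eq']
    simp

theorem plocal {ι : Type*} (p : ℕ) (hp : p.Prime) (S : Finset ι) (d : ℕ) :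
    ∀ M : ι → Fin d → ℤ, ∃ T ⊆ S, T.card ≤ d ∧ ∀ s ∈ S, ∃ N : ℤ, ¬ (p : ℤ) ∣ N ∧
      ∃ c : ι → ℤ, ∀ i, N * M s i = ∑ t ∈ T, c t * M t i := by
  have hpi : Prime (p : ℤ) := Nat.prime_iff_prime_int.1 hp
  induction d with
  | zero =>
    intro M
    exact ⟨∅, by simp, by simp, fun s _ => ⟨1, hpi.not_dvd_one, 0, fun i => i.elim0⟩⟩
  | succ d ih =>
    intro M
    by_cases h0 : ∀ s ∈ S, M s 0 = 0
    · obtain ⟨T, hTS, hTc, hT⟩ := ih fun s j => M s j.succ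
      refine ⟨T, hTS, by omega, fun s hs => ?_⟩
      obtain ⟨N, hN, c, hc⟩ := hT s hs
      refine ⟨N, hN, c, fun i => ?_⟩
      refine Fin.cases ?_ (fun j => hc j) i
      rw [h0 s hs, Finset.sum_eq_zero fun t ht => by rw [h0 t (hTS ht), mul_zero], mul_zero]
    · push Not at h0
      have hfac : ∀ x : ℤ, x ≠ 0 → ∃ a : ℕ, ∃ u : ℤ, x = (p : ℤ) ^ a * u ∧ ¬ (p : ℤ) ∣ u := by
        intro x hx
        have hf : FiniteMultiplicity (p : ℤ) x :=
          Int.finiteMultiplicity_iff.2 ⟨by simpa using hp.ne_one, hx⟩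
        obtain ⟨u, hu, hu2⟩ := hf.exists_eq_pow_mul_and_not_dvd
        exact ⟨_, u, hu, hu2⟩
      have hex : ∃ a : ℕ, ∃ t ∈ S, ∃ u : ℤ, M t 0 = (p : ℤ) ^ a * u ∧ ¬ (p : ℤ) ∣ u := by
        obtain ⟨s, hs, hs0⟩ := h0
        obtain ⟨a, u, h1, h2⟩ := hfac _ hs0
        exact ⟨a, s, hs, u, h1, h2⟩
      obtain ⟨t0, ht0, u, hu, hup⟩ := Nat.find_spec hex
      have hb : ∀ s, ∃ b : ℤ, s ∈ S → M s 0 = (p : ℤ) ^ (Nat.find hex) * b := by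
        intro s
        by_cases hs : s ∈ S
        · by_cases hz : M s 0 = 0
          · exact ⟨0, fun _ => by simp [hz]⟩
          · obtain ⟨a, v, h1, h2⟩ := hfac _ hz
            have hle := Nat.find_min' hex ⟨s, hs, v, h1, h2⟩
            obtain ⟨k, hk⟩ := Nat.exists_eq_add_of_le hle
            refine ⟨(p : ℤ) ^ k * v, fun _ => ?_⟩
            rw [h1, hk, pow_add]
            ring
        · exact ⟨0, fun h => absurd h hs⟩
      choose b hb using hb
      obtain ⟨T, hTS, hTc, hT⟩ := ih fun s j => u * M s j.succ - b s * M t0 j.succ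
      refine ⟨insert t0 T, Finset.insert_subset ht0 hTS,
        (Finset.card_insert_le _ _).trans (by omega), fun s hs => ?_⟩
      obtain ⟨N, hN, c, hc⟩ := hT s hs
      obtain ⟨c', hc'⟩ := sum_insert_coeff T t0 (fun t => c t * u) (N * b s - ∑ t ∈ T, c t * b t)
      refine ⟨N * u, fun h => (hpi.dvd_or_dvd h).elim hN hup, c', fun i => ?_⟩
      rw [hc' fun t => M t i]
      have key : ∀ s ∈ S, u * M s 0 - b s * M t0 0 = 0 := by
        intro s hs
        rw [hb s hs, hu]; ring
      have hall : N * (u * M s i - b s * M t0 i) = ∑ t ∈ T, c t * (u * M t i - b t * M t0 i) := by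
        refine Fin.cases ?_ (fun j => hc j) i
        rw [key s hs, Finset.sum_eq_zero fun t ht => by rw [key t (hTS ht), mul_zero], mul_zero]
      have e1 : ∑ t ∈ T, c t * (u * M t i - b t * M t0 i) =
          ∑ t ∈ T, c t * u * M t i - (∑ t ∈ T, c t * b t) * M t0 i := by
        rw [Finset.sum_mul, ← Finset.sum_sub_distrib]
        exact Finset.sum_congr rfl fun t _ => by ring
      rw [e1] at hall
      linear_combination hall

variable {G : Type*} [AddCommGroup G] [Fintype G]

/-- Relations between few elements of `supp A`. -/
def smallRel (A : Multiset G) (d : ℕ) : Set (G → ℤ) :=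
  {x | ∃ F : Finset G, (∀ g ∈ F, g ∈ A) ∧ F.card ≤ d + 1 ∧ (∀ g, g ∉ F → x g = 0) ∧
    ∑ g, x g • g = 0}

/-- `e` times the cross number of an integer vector. -/
noncomputable def kZ (e : ℕ) (x : G → ℤ) : ℤ := ∑ g, x g * ((e / addOrderOf g : ℕ) : ℤ)

/-- The multiset with given multiplicities. -/
noncomputable def ofCount (b : G → ℕ) : Multiset G := ∑ g, Multiset.replicate (b g) g

theorem count_ofCount (b : G → ℕ) (g : G) : (ofCount b).count g = b g := by
  unfold ofCount
  rw [Multiset.count_sum']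
  simp [Multiset.count_replicate]

theorem ofCount_count (B : Multiset G) : ofCount (fun g => B.count g) = B := by
  ext g
  rw [count_ofCount]

theorem sum_eq_count (B : Multiset G) : B.sum = ∑ g, B.count g • g := by
  conv_lhs => rw [← ofCount_count B]
  unfold ofCount
  rw [Multiset.sum_sum]
  simp

theorem kN_eq_count (e : ℕ) (B : Multiset G) :
    (kN e B : ℤ) = kZ e (fun g => (B.count g : ℤ)) := by
  conv_lhs => rw [← ofCount_count B]
  unfold ofCount kZ
  rw [kN_sum]
  simp [kN]

/-- Vectors on which length and cross number agree modulo `d`. -/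
def GoodVec (G0 : Set G) (e d : ℕ) (x : G → ℤ) : Prop :=
  ∃ (a : G → ℕ) (B : Multiset G) (l : ℕ) (z : ℤ), FacLen G0 B l ∧
    (∀ g, (B.count g : ℤ) = x g + a g * addOrderOf g) ∧
    kZ e x = e * (l - ∑ g, (a g : ℤ)) + e * (d * z)

theorem kZ_add (e : ℕ) (x y : G → ℤ) : kZ e (x + y) = kZ e x + kZ e y := by
  simp [kZ, add_mul, Finset.sum_add_distrib]

theorem kZ_ord (e : ℕ) (he : ∀ g : G, addOrderOf g ∣ e) (a : G → ℕ) :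
    kZ e (fun g => (a g : ℤ) * addOrderOf g) = e * ∑ g, (a g : ℤ) := by
  unfold kZ
  rw [Finset.mul_sum]
  refine Finset.sum_congr rfl fun g _ => ?_
  have := Nat.mul_div_cancel' (he g)
  have h2 : (addOrderOf g : ℤ) * ((e / addOrderOf g : ℕ) : ℤ) = e := by exact_mod_cast this
  rw [mul_assoc, h2, mul_comm]

theorem GoodVec.add {G0 : Set G} {e d : ℕ} {x y : G → ℤ} (hx : GoodVec G0 e d x)
    (hy : GoodVec G0 e d y) : GoodVec G0 e d (x + y) := by
  obtain ⟨a, B, l, z, h1, h2, h3⟩ := hx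
  obtain ⟨a', B', l', z', h1', h2', h3'⟩ := hy
  refine ⟨a + a', B + B', l + l', z + z', h1.add h1', fun g => ?_, ?_⟩
  · rw [Multiset.count_add]
    push_cast [Pi.add_apply]
    rw [h2, h2']; ring
  · rw [kZ_add, h3, h3']
    simp only [Pi.add_apply, Nat.cast_add, Finset.sum_add_distrib]
    ring

theorem GoodVec.zero (G0 : Set G) (e d : ℕ) : GoodVec G0 e d (0 : G → ℤ) :=
  ⟨0, 0, 0, 0, FacLen.zero G0, by simp, by simp [kZ]⟩

theorem smallRel_neg {A : Multiset G} {d : ℕ} {x : G → ℤ} (hx : x ∈ smallRel A d) :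
    -x ∈ smallRel A d := by
  obtain ⟨F, h1, h2, h3, h4⟩ := hx
  refine ⟨F, h1, h2, fun g hg => by simp [h3 g hg], ?_⟩
  simp [h4]

theorem good_of_small {G0 : Set G} {A : Multiset G} {e d : ℕ} (he0 : 0 < e)
    (he : ∀ g : G, addOrderOf g ∣ e) (hAG : ∀ g ∈ A, g ∈ G0)
    (hd : d ∣ sInf (deltaG0 G0))
    (hlcn : ∀ U, IsMinZeroSum G0 U → (∀ g ∈ U, g ∈ A) → e ≤ kN e U)
    {x : G → ℤ} (hx : x ∈ smallRel A d) : GoodVec G0 e d x := by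
  obtain ⟨F, h1, h2, h3, h4⟩ := hx
  have hnn : ∀ g, 0 ≤ x g + ((x g).natAbs : ℤ) * addOrderOf g := by
    intro g
    have hpos : (1 : ℤ) ≤ addOrderOf g := by
      exact_mod_cast Nat.pos_of_dvd_of_pos (he g) he0
    have : -x g ≤ ((x g).natAbs : ℤ) := by omega
    nlinarith [Int.natCast_nonneg (x g).natAbs]
  set b : G → ℕ := fun g => (x g + ((x g).natAbs : ℤ) * addOrderOf g).toNat with hb
  have hbz : ∀ g, (b g : ℤ) = x g + ((x g).natAbs : ℤ) * addOrderOf g := fun g =>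
    Int.toNat_of_nonneg (hnn g)
  have hcount : ∀ g, ((ofCount b).count g : ℤ) = x g + ((x g).natAbs : ℤ) * addOrderOf g :=
    fun g => by rw [count_ofCount, hbz]
  have hBF : ∀ g ∈ ofCount b, g ∈ F := by
    intro g hg
    by_contra hgF
    have h5 := hcount g
    have h6 := Multiset.count_pos.2 hg
    rw [h3 g hgF] at h5
    simp at h5
    exact h5 hg
  have hsum : (ofCount b).sum = 0 := by
    rw [sum_eq_count]
    have : ∀ g : G, (ofCount b).count g • g = x g • g := by
      intro g
      rw [← natCast_zsmul, hcount, add_zsmul, mul_zsmul, natCast_zsmul, natCast_zsmul,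
        addOrderOf_nsmul_eq_zero, nsmul_zero, add_zero]
    rw [Finset.sum_congr rfl fun g _ => this g, h4]
  obtain ⟨l, hl⟩ := exists_facLen G0 _ (fun g hg => hAG g (h1 g (hBF g hg))) hsum
  have k1 : l * e ≤ kN e (ofCount b) := kN_ge_of_fac (P := {x | x ∈ A}) hl
    (fun g hg => h1 g (hBF g hg)) hlcn
  have k2 : kN e (ofCount b) ≤ l * e := kN_le_of_fac (P := {x | x ∈ F}) hl hBF
    fun U hU hUF => small_atom he0 he hd hlcn F h1 h2 U hU hUF
  have k3 : (kN e (ofCount b) : ℤ) = l * e := by exact_mod_cast le_antisymm k2 k1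
  rw [kN_eq_count] at k3
  have k4 : (fun g => ((ofCount b).count g : ℤ)) =
      x + fun g => ((x g).natAbs : ℤ) * addOrderOf g := by
    funext g; rw [hcount]; rfl
  rw [k4, kZ_add, kZ_ord e he fun g => (x g).natAbs] at k3
  exact ⟨fun g => (x g).natAbs, ofCount b, l, 0, hl, hcount, by linear_combination k3⟩

theorem good_of_closure {G0 : Set G} {A : Multiset G} {e d : ℕ} (he0 : 0 < e)
    (he : ∀ g : G, addOrderOf g ∣ e) (hAG : ∀ g ∈ A, g ∈ G0)
    (hd : d ∣ sInf (deltaG0 G0))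
    (hlcn : ∀ U, IsMinZeroSum G0 U → (∀ g ∈ U, g ∈ A) → e ≤ kN e U)
    {x : G → ℤ} (hx : x ∈ AddSubgroup.closure (smallRel A d)) : GoodVec G0 e d x := by
  rw [← AddSubgroup.mem_toAddSubmonoid, AddSubgroup.closure_toAddSubmonoid] at hx
  induction hx using AddSubmonoid.closure_induction with
  | mem y hy =>
    rcases hy with hy | hy
    · exact good_of_small he0 he hAG hd hlcn hy
    · exact good_of_small he0 he hAG hd hlcn (neg_neg y ▸ smallRel_neg hy)
  | zero => exact GoodVec.zero G0 e d
  | add x y _ _ hx hy => exact hx.add hy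

theorem local_mem {A : Multiset G} (hA : A.sum = 0) {d q : ℕ} (T : Finset G)
    (hTA : ∀ g ∈ T, g ∈ A) (hTc : T.card ≤ d) (p : ℕ) (hp : p.Prime)
    (hT : ∀ s ∈ A.toFinset, ∃ N : ℤ, ¬ (p : ℤ) ∣ N ∧ ∃ c : G → ℤ,
      (N * q) • s = ∑ t ∈ T, (c t * q) • t) :
    ∃ N : ℤ, ¬ (p : ℤ) ∣ N ∧
      N • (fun g => (q : ℤ) * A.count g) ∈ AddSubgroup.closure (smallRel A d) := by
  have hpi : Prime (p : ℤ) := Nat.prime_iff_prime_int.1 hp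
  -- a common multiplier
  have hcommon : ∃ N : ℤ, ¬ (p : ℤ) ∣ N ∧ ∀ s ∈ A.toFinset, ∃ c : G → ℤ,
      (N * q) • s = ∑ t ∈ T, (c t * q) • t := by
    have : ∀ E : Finset G, E ⊆ A.toFinset → ∃ N : ℤ, ¬ (p : ℤ) ∣ N ∧ ∀ s ∈ E, ∃ c : G → ℤ,
      (N * q) • s = ∑ t ∈ T, (c t * q) • t := by
      intro E
      induction E using Finset.induction_on with
      | empty => exact fun _ => ⟨1, hpi.not_dvd_one, by simp⟩
      | insert a E ha ih =>
        intro hE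
        obtain ⟨N, hN, h⟩ := ih fun x hx => hE (by simp [hx])
        obtain ⟨N', hN', c', h'⟩ := hT a (hE (by simp))
        refine ⟨N * N', fun hh => (hpi.dvd_or_dvd hh).elim hN hN', ?_⟩
        intro s hs
        rcases Finset.mem_insert.1 hs with rfl | hs
        · refine ⟨fun t => N * c' t, ?_⟩
          rw [mul_assoc, mul_zsmul, h', Finset.smul_sum]
          exact Finset.sum_congr rfl fun t _ => by rw [← mul_zsmul, mul_assoc]
        · obtain ⟨c, hc⟩ := h s hs
          refine ⟨fun t => N' * c t, ?_⟩
          rw [mul_comm N, mul_assoc, mul_zsmul, hc, Finset.smul_sum]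
          exact Finset.sum_congr rfl fun t _ => by rw [← mul_zsmul, mul_assoc]
    exact this _ subset_rfl
  obtain ⟨N, hN, hc⟩ := hcommon
  refine ⟨N, hN, ?_⟩
  have hc' : ∀ s, ∃ c : G → ℤ, s ∈ A.toFinset → (N * q) • s = ∑ t ∈ T, (c t * q) • t := by
    intro s
    by_cases hs : s ∈ A.toFinset
    · obtain ⟨c, h⟩ := hc s hs
      exact ⟨c, fun _ => h⟩
    · exact ⟨0, fun h => absurd h hs⟩
  choose c hc using hc'
  set tail : G → G → ℤ := fun s g => if g ∈ T then c s g * q else 0 with htail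
  set X : G → G → ℤ := fun s g => (if g = s then N * q else 0) - tail s g with hX
  have htsum : ∀ s, ∑ g, tail s g • g = ∑ t ∈ T, (c s t * q) • t := by
    intro s
    simp only [htail, ite_smul, zero_smul]
    rw [Finset.sum_ite_mem, Finset.univ_inter]
  have hXs : ∀ s ∈ A.toFinset, X s ∈ smallRel A d := by
    intro s hs
    refine ⟨insert s T, ?_, (Finset.card_insert_le _ _).trans (by omega), ?_, ?_⟩
    · intro g hg
      rcases Finset.mem_insert.1 hg with rfl | hg
      · exact Multiset.mem_toFinset.1 hs
      · exact hTA g hg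
    · intro g hg
      rw [Finset.mem_insert, not_or] at hg
      simp [hX, htail, hg.1, hg.2]
    · simp only [hX, sub_smul, Finset.sum_sub_distrib]
      rw [htsum, ← hc s hs]
      simp [ite_smul]
  set Y : G → ℤ := fun g => ∑ s ∈ A.toFinset, (A.count s : ℤ) * tail s g with hY
  have hdec : N • (fun g => (q : ℤ) * (A.count g : ℤ)) =
      (∑ s ∈ A.toFinset, (A.count s : ℤ) • X s) + Y := by
    funext g
    simp only [Pi.smul_apply, Pi.add_apply, Finset.sum_apply, hY, hX, smul_eq_mul, mul_sub,
      Finset.sum_sub_distrib, sub_add_cancel, mul_ite, mul_zero]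
    rw [Finset.sum_ite_eq]
    split_ifs with h
    · ring
    · have : A.count g = 0 := by
        rw [Multiset.count_eq_zero]; rwa [Multiset.mem_toFinset] at h
      simp [this]
  have hrel : ∀ x : G → ℤ, x ∈ smallRel A d → ∑ g, x g • g = 0 := fun x hx => hx.choose_spec.2.2.2
  have hYs : Y ∈ smallRel A d := by
    refine ⟨T, hTA, by omega, ?_, ?_⟩
    · intro g hg
      simp [hY, htail, hg]
    · have hYe : Y = N • (fun g => (q : ℤ) * (A.count g : ℤ)) -
          (∑ s ∈ A.toFinset, (A.count s : ℤ) • X s) := by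
        rw [hdec]; abel
      rw [hYe]
      simp only [Pi.sub_apply, sub_smul, Finset.sum_sub_distrib]
      have z1 : ∑ g, (N • (fun g : G => (q : ℤ) * (A.count g : ℤ))) g • g = 0 := by
        have : ∀ g : G, (N • (fun g : G => (q : ℤ) * (A.count g : ℤ))) g • g =
            (N * q) • (A.count g • g) := by
          intro g
          simp only [Pi.smul_apply, smul_eq_mul]
          rw [← mul_assoc, mul_zsmul, natCast_zsmul]
        rw [Finset.sum_congr rfl fun g _ => this g, ← Finset.smul_sum, ← sum_eq_count, hA, smul_zero]
      have z2 : ∑ g, (∑ s ∈ A.toFinset, (A.count s : ℤ) • X s) g • g = 0 := by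
        simp only [Finset.sum_apply, Pi.smul_apply, Finset.sum_smul]
        rw [Finset.sum_comm]
        refine Finset.sum_eq_zero fun s hs => ?_
        have := hrel _ (hXs s hs)
        simp only [smul_eq_mul, mul_zsmul]
        rw [← Finset.smul_sum, this, smul_zero]
      rw [z1, z2, sub_zero]
  rw [hdec]
  exact add_mem (sum_mem fun s hs => zsmul_mem (AddSubgroup.subset_closure (hXs s hs)) _)
    (AddSubgroup.subset_closure hYs)

theorem core {G0 : Set G} {A : Multiset G} {e d q : ℕ} (he0 : 0 < e)
    (he : ∀ g : G, addOrderOf g ∣ e) (hed : e ≤ 2 * d + 1)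
    (hd : d ∣ sInf (deltaG0 G0)) (hA : IsMinZeroSum G0 A) (hk : e < kN e A)
    (hQ : ∀ p : ℕ, p.Prime → ∃ T ⊆ A.toFinset, T.card ≤ d ∧ ∀ s ∈ A.toFinset,
      ∃ N : ℤ, ¬ (p : ℤ) ∣ N ∧ ∃ c : G → ℤ, (N * q) • s = ∑ t ∈ T, (c t * q) • t) :
    ∃ z : ℤ, (q : ℤ) * kN e A = e * q + e * (d * z) := by
  have hlcn := lcn_supp he0 he hed hd hA hk
  set w : G → ℤ := fun g => (q : ℤ) * A.count g with hw
  have hmem : w ∈ AddSubgroup.closure (smallRel A d) := by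
    set H : AddSubgroup ℤ := (AddSubgroup.closure (smallRel A d)).comap (zmultiplesHom (G → ℤ) w)
      with hH
    obtain ⟨a, ha⟩ := Int.subgroup_cyclic H
    have hHmem : ∀ N : ℤ, N ∈ H ↔ N • w ∈ AddSubgroup.closure (smallRel A d) := fun N => by
      simp [hH]
    have hdiv : ∀ N : ℤ, N ∈ H → a ∣ N := by
      intro N hN
      rw [ha, AddSubgroup.mem_closure_singleton] at hN
      obtain ⟨k, hk⟩ := hN
      exact ⟨k, by rw [← hk, smul_eq_mul, mul_comm]⟩
    have haH : a ∈ H := by rw [ha]; exact AddSubgroup.mem_closure_singleton_self a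
    have ha1 : a.natAbs = 1 := by
      by_contra hne
      obtain ⟨p, hp, hpa⟩ := Nat.exists_prime_and_dvd hne
      obtain ⟨T, hTS, hTc, hT⟩ := hQ p hp
      obtain ⟨N, hN, hNm⟩ := local_mem hA.2.2.1 T
        (fun g hg => Multiset.mem_toFinset.1 (hTS hg)) hTc p hp hT
      exact hN ((Int.natCast_dvd.2 hpa).trans (hdiv N ((hHmem N).2 hNm)))
    have h1 : (1 : ℤ) ∈ H := by
      rcases Int.natAbs_eq a with h | h
      · rw [ha1] at h; rw [h] at haH; simpa using haH
      · rw [ha1] at h; rw [h] at haH; simpa using H.neg_mem haH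
    simpa using (hHmem 1).1 h1
  obtain ⟨a, B, l, z, h1, h2, h3⟩ := good_of_closure he0 he hA.2.1 hd hlcn hmem
  have hB : B = q • A + ∑ g, a g • Multiset.replicate (addOrderOf g) g := by
    ext g
    have := h2 g
    simp only [hw] at this
    rw [Multiset.count_add, Multiset.count_nsmul, Multiset.count_sum']
    simp only [Multiset.count_nsmul, Multiset.count_replicate, mul_ite, mul_zero]
    rw [Finset.sum_ite_eq' Finset.univ g]
    simp only [Finset.mem_univ, if_true]
    exact_mod_cast this
  have f2 : FacLen G0 B (q * 1 + ∑ g, a g * 1) := by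
    rw [hB]
    refine ((FacLen.atom hA).nsmul q).add (FacLen.sum _ _ _ fun g _ => ?_)
    by_cases hz : a g = 0
    · rw [hz]; simpa using FacLen.zero G0
    · have hpos := Nat.pos_of_dvd_of_pos (he g) he0
      have hgB : g ∈ B := by
        rw [← Multiset.count_pos]
        have h5 := h2 g
        have h6 : (0 : ℤ) < a g * addOrderOf g := by
          have : 0 < a g := Nat.pos_of_ne_zero hz
          positivity
        have h7 : 0 ≤ w g := by simp only [hw]; positivity
        omega
      exact (FacLen.atom (atom_replicate (h1.isZeroSum.1 g hgB) hpos)).nsmul _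
  obtain ⟨y, hy⟩ := dvd_sub_of_facLen hd f2 h1
  push_cast at hy
  simp only [mul_one] at hy
  have hkw : kZ e w = q * kN e A := by
    rw [kN_eq_count]
    unfold kZ
    rw [Finset.mul_sum]
    exact Finset.sum_congr rfl fun g _ => by simp only [hw]; ring
  refine ⟨y + z, ?_⟩
  rw [← hkw, h3]
  linear_combination (e : ℤ) * hy

end Aux2

/-- Suppose `G ≅ C_{n₁} ⊕ … ⊕ C_{n_r}` with `1 < n₁ ∣ … ∣ n_r`,
`D(G) ≥ 4`, `r ≥ ⌊n_r/2⌋ + 1`, `d ∈ Δ₁(G)` with `⌊n_r/2⌋ ≤ d ≤ r − 1`, and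
`G₀ ⊆ G` with `d ∣ min Δ(G₀)`. If `A ∈ 𝓐(G₀)` has `k(A) > 1`, then
`k(A) = 1 + s·d/n_{r−d}` for some `s ∈ ℕ`. -/
theorem stmt10 {G : Type*} [AddCommGroup G] [Fintype G]
    (r : ℕ) (hr : 0 < r) (n : Fin r → ℕ) (hn : ∀ i, 1 < n i)
    (hdvd : ∀ i j : Fin r, i ≤ j → n i ∣ n j)
    (hG : Nonempty (G ≃+ (∀ i : Fin r, ZMod (n i))))
    (hD : 4 ≤ davenport G)
    (hbig : n ⟨r - 1, by omega⟩ / 2 + 1 ≤ r)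
    (d : ℕ) (hd : d ∈ delta1 G) (hd1 : n ⟨r - 1, by omega⟩ / 2 ≤ d) (hd2 : d ≤ r - 1)
    (G0 : Set G) (hdvd0 : d ∣ sInf (deltaG0 G0))
    (A : Multiset G) (hA : IsMinZeroSum G0 A) (hk : 1 < crossNum A) :
    ∃ s : ℕ, 0 < s ∧
      crossNum A = 1 + (s : ℝ) * (d : ℝ) / ((n ⟨r - d - 1, by omega⟩ : ℕ) : ℝ) := by
  obtain ⟨φ⟩ := hG
  set e := n ⟨r - 1, by omega⟩ with he_def
  have he0 : 0 < e := lt_trans Nat.zero_lt_one (hn _)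
  have hordi : ∀ (i : Fin r) (x : ZMod (n i)) (m : ℕ), n i ∣ m → m • x = 0 := by
    intro i x m hm
    rw [nsmul_eq_mul, (ZMod.natCast_eq_zero_iff m (n i)).2 hm, zero_mul]
  have he : ∀ g : G, addOrderOf g ∣ e := by
    intro g
    apply addOrderOf_dvd_of_nsmul_eq_zero
    apply φ.injective
    rw [map_nsmul, map_zero]
    funext i
    exact hordi i _ _ (hdvd i _ (Fin.le_def.2 (by simp; omega)))
  have hkN : e < kN e A := by
    have h1 := crossNum_eq e he0 he A
    have h2 : (0 : ℝ) < e := by exact_mod_cast he0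
    have h3 : (e : ℝ) < kN e A := by rw [h1]; nlinarith
    exact_mod_cast h3
  set q := n ⟨r - d - 1, by omega⟩ with hq_def
  have hq0 : 0 < q := lt_trans Nat.zero_lt_one (hn _)
  have hQ : ∀ p : ℕ, p.Prime → ∃ T ⊆ A.toFinset, T.card ≤ d ∧ ∀ s ∈ A.toFinset,
      ∃ N : ℤ, ¬ (p : ℤ) ∣ N ∧ ∃ c : G → ℤ, (N * q) • s = ∑ t ∈ T, (c t * q) • t := by
    intro p hp
    have hjr : ∀ j : Fin d, r - d + (j : ℕ) < r := fun j => by omega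
    obtain ⟨T, hTS, hTc, hT⟩ := plocal p hp A.toFinset d
      (fun g j => ((φ g ⟨r - d + j, hjr j⟩).cast : ℤ))
    refine ⟨T, hTS, hTc, fun s hs => ?_⟩
    obtain ⟨N, hN, c, hc⟩ := hT s hs
    refine ⟨N, hN, c, ?_⟩
    apply φ.injective
    rw [map_zsmul, map_sum]
    simp only [map_zsmul]
    funext i
    simp only [Pi.smul_apply, Finset.sum_apply, mul_comm _ (q : ℤ), mul_zsmul, natCast_zsmul]
    rw [← Finset.smul_sum]
    by_cases hi : (i : ℕ) < r - d
    · have hdv : n i ∣ q := hdvd i _ (Fin.le_def.2 (by simp; omega))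
      rw [hordi i _ _ hdv, hordi i _ _ hdv]
    · congr 1
      obtain ⟨j, rfl⟩ : ∃ j : Fin d, i = ⟨r - d + j, hjr j⟩ :=
        ⟨⟨i - (r - d), by omega⟩, Fin.ext (by simp; omega)⟩
      have hj := hc j
      have := congrArg (Int.cast : ℤ → ZMod (n ⟨r - d + j, hjr j⟩)) hj
      push_cast [ZMod.intCast_zmod_cast] at this
      simpa [zsmul_eq_mul] using this
  obtain ⟨z, hz⟩ := core he0 he (by omega) hdvd0 hA hkN hQ
  have hzR : (q : ℝ) * kN e A = e * q + e * (d * z) := by exact_mod_cast hz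
  rw [crossNum_eq e he0 he A] at hzR
  have heR : (0 : ℝ) < e := by exact_mod_cast he0
  have hqR : (0 : ℝ) < q := by exact_mod_cast hq0
  have hmain : (q : ℝ) * crossNum A = q + d * z := by
    apply mul_left_cancel₀ heR.ne'
    linear_combination hzR
  have hzpos : 0 < z := by
    have h1 : (0 : ℝ) < d * z := by nlinarith
    by_contra hcon
    push Not at hcon
    have : (z : ℝ) ≤ 0 := by exact_mod_cast hcon
    have hd0 : (0 : ℝ) ≤ d := by positivity
    nlinarith
  refine ⟨z.toNat, by omega, ?_⟩
  have hzc : ((z.toNat : ℕ) : ℝ) = (z : ℝ) := by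
    have : ((z.toNat : ℕ) : ℤ) = z := Int.toNat_of_nonneg hzpos.le
    exact_mod_cast this
  rw [hzc]
  field_simp
  linear_combination hmain
end

section
/- Assume G ≅ C_{n1} ⊕ … ⊕ C_{nr} with 1 < n1 | … | nr and D(G) ≥ 4, and suppose r ≥ ⌊nr/2⌋ + 1. If n1 is not a prime power, then K(G, r−1) > r. -/
/- Common definitions: zero-sum sequences over a finite abelian group,
   sets of lengths, the system of sets of lengths, the Davenport constant,
   sets of distances, elasticities, AAPs, Δ₁(G), ρ(G,d,k), ρ(G,d), ρ*(G,d),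
   cross numbers, K(G₀), K(G,d), LCN-sets, Δ*(G). -/

open scoped Classical

section Helpers

variable {G : Type*} [AddCommGroup G]

lemma mem_lengthSet_of_multiset (G0 : Set G) (M : Multiset (Multiset G))
    (hM : ∀ A ∈ M, IsMinZeroSum G0 A) : Multiset.card M ∈ lengthSet G0 M.sum := by
  induction M using Quotient.inductionOn with
  | h l =>
    refine ⟨fun i => l.get i, fun i => hM _ ?_, ?_⟩
    · exact List.get_mem l i
    · simp only [Multiset.quot_mk_to_coe, Multiset.sum_coe]
      exact (List.sum_ofFn (f := fun i => l.get i)).symm.trans (by simp) |>.symm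

lemma isMinZeroSum_replicate [Finite G] (G0 : Set G) (g : G) (hg : g ∈ G0) :
    IsMinZeroSum G0 (Multiset.replicate (addOrderOf g) g) := by
  have hpos := addOrderOf_pos g
  refine ⟨?_, ?_, ?_, ?_⟩
  · intro h
    have := congrArg Multiset.card h
    simp only [Multiset.card_replicate, Multiset.card_zero] at this
    omega
  · intro y hy
    rw [Multiset.eq_of_mem_replicate hy]; exact hg
  · simp [addOrderOf_nsmul_eq_zero]
  · intro T hT hs
    obtain ⟨k, hk, rfl⟩ := Multiset.le_replicate_iff.1 hT
    rw [Multiset.sum_replicate, ← addOrderOf_dvd_iff_nsmul_eq_zero] at hs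
    rcases Nat.eq_zero_or_pos k with h0 | h0
    · left; simp [h0]
    · right
      rw [Nat.le_antisymm hk (Nat.le_of_dvd h0 hs)]

lemma eq_replicate_of_le_count [Finite G] {G0 : Set G} {A : Multiset G}
    (hA : IsMinZeroSum G0 A) (g : G) (h : addOrderOf g ≤ A.count g) :
    A = Multiset.replicate (addOrderOf g) g := by
  have hle : Multiset.replicate (addOrderOf g) g ≤ A := Multiset.le_count_iff_replicate_le.1 h
  rcases hA.2.2.2 _ hle (by simp [addOrderOf_nsmul_eq_zero]) with h1 | h1
  · have := congrArg Multiset.card h1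
    simp only [Multiset.card_replicate, Multiset.card_zero] at this
    have := addOrderOf_pos g
    omega
  · exact h1.symm

lemma count_le_of_atom [Finite G] {G0 : Set G} {A : Multiset G}
    (hA : IsMinZeroSum G0 A) (g : G) : A.count g ≤ addOrderOf g := by
  by_contra hc
  push Not at hc
  have := eq_replicate_of_le_count hA g hc.le
  rw [this] at hc
  simp at hc

lemma crossNum_le [Fintype G] {G0 : Set G} {A : Multiset G}
    (hA : IsMinZeroSum G0 A) : crossNum A ≤ Fintype.card G := by
  unfold crossNum
  rw [Finset.sum_multiset_map_count]
  calc _ ≤ ∑ g ∈ A.toFinset, (1 : ℝ) := by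
        refine Finset.sum_le_sum fun g _ => ?_
        have h1 := count_le_of_atom hA g
        have h2 : (0 : ℝ) < addOrderOf g := by exact_mod_cast addOrderOf_pos g
        rw [nsmul_eq_mul, mul_one_div, div_le_one h2]
        exact_mod_cast h1
    _ = (A.toFinset.card : ℝ) := by simp
    _ ≤ Fintype.card G := by exact_mod_cast Finset.card_le_univ _

lemma crossNum_le_KG0 [Fintype G] {G0 : Set G} {A : Multiset G}
    (hA : IsMinZeroSum G0 A) : crossNum A ≤ KG0 G0 := by
  refine le_csSup ⟨(Fintype.card G : ℝ), ?_⟩ ⟨A, hA, rfl⟩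
  rintro x ⟨B, hB, rfl⟩
  exact crossNum_le hB

lemma KG0_le_KGd [Fintype G] (G0 : Set G) (d : ℕ) (h1 : deltaG0 G0 ≠ ∅)
    (h2 : d ∣ sInf (deltaG0 G0)) : KG0 G0 ≤ KGd G d := by
  refine le_csSup ?_ ⟨G0, h1, h2, rfl⟩
  apply Set.Finite.bddAbove
  refine (Set.finite_range (fun G0 : Set G => KG0 G0)).subset ?_
  rintro x ⟨G1, _, _, rfl⟩
  exact ⟨G1, rfl⟩

lemma delta_ne_empty_of_two (G0 : Set G) (B : Multiset G) (hB : IsZeroSumSeq G0 B)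
    (k l : ℕ) (hk : k ∈ lengthSet G0 B) (hl : l ∈ lengthSet G0 B) (hkl : k < l) :
    deltaG0 G0 ≠ ∅ := by
  have hex : ∃ c, k < c ∧ c ∈ lengthSet G0 B := ⟨l, hkl, hl⟩
  rw [← Set.nonempty_iff_ne_empty]
  obtain ⟨h1, h2⟩ := Nat.find_spec hex
  refine ⟨Nat.find hex - k, ?_⟩
  simp only [deltaG0, Set.mem_iUnion]
  refine ⟨_, ⟨B, hB, rfl⟩, by omega, k, hk, ?_, ?_⟩
  · rw [Nat.add_sub_cancel' h1.le]; exact h2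
  · rintro c hc ⟨h3, h4⟩
    rw [Nat.add_sub_cancel' h1.le] at h4
    exact Nat.find_min hex h4 ⟨h3, hc⟩

/-- An atom of cross number greater than one gives non-half-factoriality. -/
lemma delta_ne_empty_of_crossNum [Fintype G] (G0 : Set G) (A : Multiset G)
    (hA : IsMinZeroSum G0 A) (hk : 1 < crossNum A) : deltaG0 G0 ≠ ∅ := by
  set N := Fintype.card G with hN
  have hNpos : 0 < N := Fintype.card_pos
  have h1 : N ∈ lengthSet G0 (N • A) := by
    have := mem_lengthSet_of_multiset G0 (Multiset.replicate N A) (fun B hB => by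
      rw [Multiset.eq_of_mem_replicate hB]; exact hA)
    simpa using this
  have h2 : (A.map (fun g => N / addOrderOf g)).sum ∈ lengthSet G0 (N • A) := by
    have := mem_lengthSet_of_multiset G0
      (A.bind fun g => Multiset.replicate (N / addOrderOf g)
        (Multiset.replicate (addOrderOf g) g)) (fun B hB => by
      rw [Multiset.mem_bind] at hB
      obtain ⟨g, hg, hB⟩ := hB
      rw [Multiset.eq_of_mem_replicate hB]
      exact isMinZeroSum_replicate G0 g (hA.2.1 g hg))
    rw [Multiset.card_bind, Multiset.sum_bind] at this
    have e1 : A.map (fun g => N / addOrderOf g) = A.map (Multiset.card ∘ fun g =>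
        Multiset.replicate (N / addOrderOf g) (Multiset.replicate (addOrderOf g) g)) := by
      refine Multiset.map_congr rfl fun g _ => ?_
      simp
    have e2 : (fun g : G => (Multiset.replicate (N / addOrderOf g)
          (Multiset.replicate (addOrderOf g) g)).sum) = fun g => N • ({g} : Multiset G) := by
      funext g
      rw [Multiset.sum_replicate, ← Multiset.nsmul_singleton, ← mul_nsmul',
        Nat.div_mul_cancel addOrderOf_dvd_card]
    rw [e1]
    rw [e2, Multiset.sum_map_nsmul, Multiset.sum_map_singleton] at this
    exact this
  refine delta_ne_empty_of_two G0 (N • A) ⟨?_, ?_⟩ _ _ h1 h2 ?_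
  · intro g hg
    exact hA.2.1 g (Multiset.mem_of_mem_nsmul hg)
  · rw [Multiset.sum_nsmul, hA.2.2.1, nsmul_zero]
  · have : (((A.map (fun g => N / addOrderOf g)).sum : ℕ) : ℝ) = N * crossNum A := by
      unfold crossNum
      rw [← Multiset.sum_map_mul_left, Nat.cast_multiset_sum, Multiset.map_map]
      congr 1
      refine Multiset.map_congr rfl fun g _ => ?_
      have : (addOrderOf g : ℝ) ≠ 0 := by exact_mod_cast (addOrderOf_pos g).ne'
      simp only [Function.comp]
      rw [Nat.cast_div addOrderOf_dvd_card this]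
      ring
    have h3 : (0 : ℝ) < N := by exact_mod_cast hNpos
    have : (N : ℝ) < (((A.map (fun g => N / addOrderOf g)).sum : ℕ) : ℝ) := by
      rw [this]; nlinarith
    exact_mod_cast this

/-- If an additive weight is congruent to `N` modulo `N * d` on all atoms, then `d` divides
all distances. -/
lemma dvd_sInf_delta (G0 : Set G) (W : Multiset G →+ ℕ) (N d : ℕ) (hN : 0 < N)
    (hW : ∀ A, IsMinZeroSum G0 A → ∃ t, W A = N * (1 + d * t))
    (hne : deltaG0 G0 ≠ ∅) : d ∣ sInf (deltaG0 G0) := by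
  have hlen : ∀ B k, k ∈ lengthSet G0 B → ∃ t, W B = N * (k + d * t) := by
    rintro B k ⟨U, hU, rfl⟩
    choose t ht using fun i => hW (U i) (hU i)
    refine ⟨∑ i, t i, ?_⟩
    rw [map_sum, Finset.sum_congr rfl fun i _ => ht i, ← Finset.mul_sum, Finset.sum_add_distrib,
      ← Finset.mul_sum]
    simp
  have hmem := Nat.sInf_mem (Set.nonempty_iff_ne_empty.2 hne)
  set e := sInf (deltaG0 G0)
  simp only [deltaG0, Set.mem_iUnion] at hmem
  obtain ⟨L, ⟨B, hB, rfl⟩, he, a, ha, hae, -⟩ := hmem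
  obtain ⟨t, ht⟩ := hlen B _ ha
  obtain ⟨u, hu⟩ := hlen B _ hae
  have h : a + d * t = a + e + d * u := Nat.eq_of_mul_eq_mul_left hN (ht.symm.trans hu)
  have h3 : d * t = d * u + e := by omega
  exact (Nat.dvd_add_right (Dvd.intro _ rfl)).1 (h3 ▸ Dvd.intro _ rfl)

lemma crossNum_add (A B : Multiset G) : crossNum (A + B) = crossNum A + crossNum B := by
  simp [crossNum]

lemma crossNum_sum {ι : Type*} (t : Finset ι) (f : ι → Multiset G) :
    crossNum (∑ i ∈ t, f i) = ∑ i ∈ t, crossNum (f i) :=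
  map_sum (AddMonoidHom.mk' (crossNum (G := G)) crossNum_add) f t

lemma crossNum_replicate (k : ℕ) (g : G) :
    crossNum (Multiset.replicate k g) = k / addOrderOf g := by
  simp [crossNum, div_eq_mul_inv]

/-- The core construction. -/
lemma core_s12 [Fintype G] (s : ℕ) (hs : 0 < s) (n : ℕ) (P : Bool → ℕ)
    (hP : ∀ b, P b ∣ n) (hP2 : ∀ b, 2 ≤ P b) (hPne : P true ≠ P false) (hn : 0 < n)
    (m : Option (Bool × Fin s) → ℕ) (hm0 : m none = n) (hm : ∀ b i, m (some (b, i)) = P b)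
    (x : Option (Bool × Fin s) → G)
    (hx : ∀ c : Option (Bool × Fin s) → ℤ, ∑ i, c i • x i = 0 ↔ ∀ i, (m i : ℤ) ∣ c i) :
    ((s + 1 : ℕ) : ℝ) < KGd G s := by
  have : Nonempty (Fin s) := ⟨⟨0, hs⟩⟩
  have hxn : ∀ c : Option (Bool × Fin s) → ℕ, ∑ i, c i • x i = 0 ↔ ∀ i, m i ∣ c i := by
    intro c
    have := hx (fun i => (c i : ℤ))
    simpa [Int.natCast_dvd_natCast] using this
  have hmn : ∀ i, m i ∣ n := by
    rintro (_ | ⟨b, i⟩)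
    · rw [hm0]
    · rw [hm]; exact hP b
  have hm2 : ∀ i, 2 ≤ m i := by
    rintro (_ | ⟨b, i⟩)
    · rw [hm0]; exact (hP2 true).trans (Nat.le_of_dvd hn (hP true))
    · rw [hm]; exact hP2 b
  have hnot : ∀ i, ¬ ((m i : ℤ) ∣ 1) := by
    intro i h
    have h1 := hm2 i
    have h2 := Int.le_of_dvd one_pos h
    omega
  have hinj : ∀ i j, x i = x j → i = j := by
    intro i j hij
    by_contra hne
    have h := (hx (Pi.single i 1 - Pi.single j 1)).1 (by
      simp [sub_smul, Finset.sum_sub_distrib, Pi.single_apply, ite_smul, hij]) i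
    simp [Pi.single_apply, hne] at h
    exact hnot i (by simpa using h)
  set g : G := ∑ i, x i with hg
  have hgx : ∀ i, x i ≠ g := by
    intro i hi
    obtain ⟨k, hk⟩ := exists_ne i
    have h := (hx (1 - Pi.single i 1)).1 (by
      simp [sub_smul, Finset.sum_sub_distrib, Pi.single_apply, ite_smul, ← hg, hi]) k
    simp only [Pi.sub_apply, Pi.one_apply, Pi.single_apply, hk, if_false, sub_zero] at h
    exact hnot k h
  have hordx : ∀ i, addOrderOf (x i) = m i := by
    intro i
    refine Nat.dvd_right_iff_eq.1 fun k => ?_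
    rw [addOrderOf_dvd_iff_nsmul_eq_zero]
    have := hxn (Pi.single i k)
    simp only [Pi.single_apply, ite_smul, zero_smul, Finset.sum_ite_eq', Finset.mem_univ,
      if_true] at this
    rw [this]
    constructor
    · intro h; simpa using h i
    · intro h l
      by_cases hl : l = i
      · subst hl; simpa using h
      · simp [hl]
  have hordg : addOrderOf g = n := by
    refine Nat.dvd_right_iff_eq.1 fun k => ?_
    rw [addOrderOf_dvd_iff_nsmul_eq_zero, hg, Finset.smul_sum, hxn (fun _ => k)]
    exact ⟨fun h => hm0 ▸ h none, fun h i => (hmn i).trans h⟩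
  let D : ℕ → (Option (Bool × Fin s) → ℕ) → Multiset G := fun j a =>
    Multiset.replicate j g + ∑ i, Multiset.replicate (a i) (x i)
  have hDg : ∀ j a, (D j a).count g = j := by
    intro j a
    simp [D, Multiset.count_sum', Multiset.count_replicate, hgx]
  have hDx : ∀ j a i, (D j a).count (x i) = a i := by
    intro j a i
    have h1 : ∀ k, x k = x i ↔ k = i := fun k => ⟨hinj k i, fun h => h ▸ rfl⟩
    simp [D, Multiset.count_sum', Multiset.count_replicate, (hgx i).symm, h1, -Fintype.sum_option]
  set G0 : Set G := insert g (Set.range x) with hG0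
  have hdec : ∀ T : Multiset G, (∀ y ∈ T, y ∈ G0) →
      T = D (T.count g) (fun i => T.count (x i)) := by
    intro T hT
    ext y
    by_cases hy : y ∈ G0
    · rcases hy with rfl | ⟨i, rfl⟩
      · rw [hDg]
      · rw [hDx]
    · rw [Multiset.count_eq_zero_of_notMem (fun h => hy (hT y h))]
      symm
      rw [Multiset.count_eq_zero]
      intro h
      simp only [D, Multiset.mem_add, Multiset.mem_sum] at h
      rcases h with h | ⟨i, -, h⟩
      · exact hy (Or.inl (Multiset.eq_of_mem_replicate h))
      · exact hy (Or.inr ⟨i, (Multiset.eq_of_mem_replicate h).symm⟩)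
  have hDsum : ∀ j a, (D j a).sum = ∑ i, (j + a i) • x i := by
    intro j a
    simp only [D, Multiset.sum_add, Multiset.sum_replicate, add_smul, Finset.sum_add_distrib,
      Multiset.sum_sum, hg, Finset.smul_sum]
  have hzero : ∀ T : Multiset G, (∀ y ∈ T, y ∈ G0) → T.sum = 0 →
      ∀ i, m i ∣ T.count g + T.count (x i) := by
    intro T hT h0
    rw [hdec T hT, hDsum, hxn (fun i => T.count g + T.count (x i))] at h0
    exact h0
  -- the weight
  let W : Multiset G →+ ℕ :=
    ∑ i, (n / m i) • (Multiset.countAddMonoidHom g + Multiset.countAddMonoidHom (x i))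
  have hWapp : ∀ T, W T = ∑ i, (n / m i) * (T.count g + T.count (x i)) := by
    intro T
    simp [W, mul_add]
  have hW : ∀ A, IsMinZeroSum G0 A → ∃ t, W A = n * (1 + s * t) := by
    intro A hA
    by_cases hc : ∃ i, m i ≤ A.count (x i)
    · obtain ⟨i, hi⟩ := hc
      have h := eq_replicate_of_le_count hA (x i) (by rw [hordx]; exact hi)
      rw [hordx] at h
      refine ⟨0, ?_⟩
      have h1 : ∀ k, x i = x k ↔ i = k := fun k => ⟨hinj i k, fun h => h ▸ rfl⟩
      rw [hWapp, h]
      simp [Multiset.count_replicate, hgx, h1, Nat.div_mul_cancel (hmn i)]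
    · push Not at hc
      have hz := hzero A hA.2.1 hA.2.2.1
      have hj : A.count g ≤ n := hordg ▸ count_le_of_atom hA g
      have hjpos : 0 < A.count g := by
        rcases Nat.eq_zero_or_pos (A.count g) with h0 | h0
        · exfalso
          apply hA.1
          rw [hdec A hA.2.1]
          have : ∀ i, A.count (x i) = 0 := by
            intro i
            have h1 := hz i
            rw [h0, zero_add] at h1
            exact Nat.eq_zero_of_dvd_of_lt h1 (hc i)
          simp [D, h0, this]
        · exact h0
      have hfirst : A.count g + A.count (x none) = n := by
        obtain ⟨u, hu⟩ := hz none
        have h1 := hc none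
        rw [hm0] at hu h1
        have : u = 1 := by
          have : u < 2 := by
            by_contra h
            push Not at h
            nlinarith
          have : u ≠ 0 := by
            rintro rfl
            omega
          omega
        rw [hu, this, mul_one]
      let i0 : Fin s := ⟨0, hs⟩
      choose v hv using fun b => hz (some (b, i0))
      have hblock : ∀ b i, A.count g + A.count (x (some (b, i))) = P b * v b := by
        intro b i
        rw [← hm b i0, ← hv b]
        congr 1
        have h1 := hz (some (b, i))
        have h2 := hz (some (b, i0))
        have h3 := hc (some (b, i))
        have h4 := hc (some (b, i0))
        rw [hm] at h1 h2 h3 h4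
        have h5 : A.count g + A.count (x (some (b, i))) ≡
            A.count g + A.count (x (some (b, i0))) [MOD P b] :=
          ((Nat.modEq_zero_iff_dvd.2 h1).trans (Nat.modEq_zero_iff_dvd.2 h2).symm)
        exact Nat.ModEq.eq_of_lt_of_lt (Nat.ModEq.add_left_cancel' _ h5) h3 h4
      refine ⟨∑ b, v b, ?_⟩
      rw [hWapp, Fintype.sum_option, Fintype.sum_prod_type, hfirst, hm0, Nat.div_self hn]
      simp only [hblock, hm]
      have h6 : ∀ b, n / P b * (P b * v b) = n * v b := by
        intro b
        rw [← mul_assoc, Nat.div_mul_cancel (hP b)]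
      simp only [h6, Finset.sum_const, Finset.card_univ, Fintype.card_fin, smul_eq_mul,
        Fintype.sum_bool]
      ring
  -- the long atom
  set A : Multiset G := D 1 (fun i => m i - 1) with hAdef
  have hAg : A.count g = 1 := hDg _ _
  have hAx : ∀ i, A.count (x i) = m i - 1 := fun i => hDx _ _ i
  have hAG0 : ∀ y ∈ A, y ∈ G0 := by
    intro y h
    simp only [hAdef, D, Multiset.mem_add, Multiset.mem_sum] at h
    rcases h with h | ⟨i, -, h⟩
    · exact Or.inl (Multiset.eq_of_mem_replicate h)
    · exact Or.inr ⟨i, (Multiset.eq_of_mem_replicate h).symm⟩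
  have hA : IsMinZeroSum G0 A := by
    refine ⟨?_, hAG0, ?_, ?_⟩
    · intro h
      rw [h] at hAg
      simp at hAg
    · rw [hAdef, hDsum, hxn (fun i => 1 + (m i - 1))]
      intro i
      have := hm2 i
      rw [Nat.add_sub_cancel' (by omega)]
    · intro T hT h0
      have hTG : ∀ y ∈ T, y ∈ G0 := fun y hy => hAG0 y (Multiset.mem_of_le hT hy)
      have hz := hzero T hTG h0
      have hcg : T.count g ≤ 1 := hAg ▸ Multiset.count_le_of_le g hT
      have hcx : ∀ i, T.count (x i) ≤ m i - 1 := fun i =>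
        hAx i ▸ Multiset.count_le_of_le (x i) hT
      rcases Nat.le_one_iff_eq_zero_or_eq_one.1 hcg with h1 | h1
      · left
        have h2 : ∀ i, T.count (x i) = 0 := by
          intro i
          have h3 := hz i
          rw [h1, zero_add] at h3
          have := hcx i
          have := hm2 i
          exact Nat.eq_zero_of_dvd_of_lt h3 (by omega)
        rw [hdec T hTG]
        simp [D, h1, h2]
      · right
        have h2 : ∀ i, T.count (x i) = m i - 1 := by
          intro i
          have h3 := Nat.le_of_dvd (by omega) (hz i)
          have := hcx i
          omega
        rw [hdec T hTG, hAdef, h1]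
        simp only [h2]
  have hcross : ((s + 1 : ℕ) : ℝ) < crossNum A := by
    have hcast : ∀ i, (((m i - 1 : ℕ)) : ℝ) = (m i : ℝ) - 1 := by
      intro i
      have := hm2 i
      push_cast [Nat.cast_sub (show 1 ≤ m i by omega)]
      ring
    have hval : crossNum A = 1 / n + ((n : ℝ) - 1) / n +
        s * (((P true : ℝ) - 1) / P true + ((P false : ℝ) - 1) / P false) := by
      rw [hAdef]
      simp only [D]
      rw [crossNum_add, crossNum_sum]
      simp only [crossNum_replicate, hordg, hordx, hcast]
      rw [Fintype.sum_option, Fintype.sum_prod_type]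
      simp only [hm, hm0, Finset.sum_const, Finset.card_univ, Fintype.card_fin, nsmul_eq_mul,
        Fintype.sum_bool]
      push_cast
      ring
    have hnR : (0 : ℝ) < n := by exact_mod_cast hn
    have hsR : (0 : ℝ) < s := by exact_mod_cast hs
    have e1 : (1 : ℝ) / n + ((n : ℝ) - 1) / n = 1 := by field_simp; ring
    have key : (1 : ℝ) < ((P true : ℝ) - 1) / P true + ((P false : ℝ) - 1) / P false := by
      have hp := hP2 true
      have hq := hP2 false
      have hpR : (2 : ℝ) ≤ P true := by exact_mod_cast hp
      have hqR : (2 : ℝ) ≤ P false := by exact_mod_cast hq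
      rw [div_add_div _ _ (by positivity) (by positivity), lt_div_iff₀ (by positivity)]
      rcases Nat.lt_or_gt_of_ne hPne with h | h
      · have : (3 : ℝ) ≤ P false := by exact_mod_cast (show 3 ≤ P false by omega)
        nlinarith
      · have : (3 : ℝ) ≤ P true := by exact_mod_cast (show 3 ≤ P true by omega)
        nlinarith
    rw [hval, e1]
    push_cast
    nlinarith
  have hone : 1 < crossNum A := by
    refine lt_of_le_of_lt ?_ hcross
    push_cast
    have : (0 : ℝ) ≤ s := Nat.cast_nonneg s
    linarith
  have hne := delta_ne_empty_of_crossNum G0 A hA hone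
  have hdvd := dvd_sInf_delta G0 W n s hn hW hne
  exact hcross.trans_le ((crossNum_le_KG0 hA).trans (KG0_le_KGd G0 s hne hdvd))

lemma dvd_pair (n p q : ℕ) (hn : 0 < n) (hpq : Nat.Coprime p q) (hp : p ∣ n) (hq : q ∣ n)
    (a b : ℤ) :
    (n : ℤ) ∣ a * (n / p : ℕ) + b * (n / q : ℕ) ↔ (p : ℤ) ∣ a ∧ (q : ℤ) ∣ b := by
  obtain ⟨t, rfl⟩ := hpq.mul_dvd_of_dvd_of_dvd hp hq
  have hp0 : 0 < p := Nat.pos_of_ne_zero (by rintro rfl; simp at hn)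
  have hq0 : 0 < q := Nat.pos_of_ne_zero (by rintro rfl; simp at hn)
  have ht0 : 0 < t := Nat.pos_of_ne_zero (by rintro rfl; simp at hn)
  have e1 : p * q * t / p = q * t := by
    rw [mul_assoc, Nat.mul_div_cancel_left _ hp0]
  have e2 : p * q * t / q = p * t := by
    rw [mul_comm p q, mul_assoc, Nat.mul_div_cancel_left _ hq0]
  have hc : IsCoprime (p : ℤ) (q : ℤ) := Nat.isCoprime_iff_coprime.2 hpq
  rw [e1, e2]
  push_cast
  have htz : (t : ℤ) ≠ 0 := by exact_mod_cast ht0.ne'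
  rw [show a * ((q : ℤ) * t) + b * (p * t) = (a * q + b * p) * t by ring,
    mul_dvd_mul_iff_right htz]
  constructor
  · intro h
    constructor
    · have h1 : (p : ℤ) ∣ a * q + b * p := (Dvd.intro _ rfl).trans h
      exact hc.dvd_of_dvd_mul_right ((dvd_add_left (Dvd.intro_left _ rfl)).1 h1)
    · have h1 : (q : ℤ) ∣ a * q + b * p := (Dvd.intro_left _ rfl).trans h
      exact hc.symm.dvd_of_dvd_mul_right ((dvd_add_right (Dvd.intro_left _ rfl)).1 h1)
  · rintro ⟨⟨u, rfl⟩, ⟨v, rfl⟩⟩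
    exact ⟨u + v, by ring⟩

end Helpers


/-- Suppose `G ≅ C_{n₁} ⊕ … ⊕ C_{n_r}` with `1 < n₁ ∣ … ∣ n_r`,
`D(G) ≥ 4` and `r ≥ ⌊n_r/2⌋ + 1`. If `n₁` is not a prime power, then
`K(G, r−1) > r`. -/
theorem stmt12 {G : Type*} [AddCommGroup G] [Fintype G]
    (r : ℕ) (hr : 0 < r) (n : Fin r → ℕ) (hn : ∀ i, 1 < n i)
    (hdvd : ∀ i j : Fin r, i ≤ j → n i ∣ n j)
    (hG : Nonempty (G ≃+ (∀ i : Fin r, ZMod (n i))))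
    (hD : 4 ≤ davenport G)
    (hbig : n ⟨r - 1, by omega⟩ / 2 + 1 ≤ r) (hpp : ¬ IsPrimePow (n ⟨0, hr⟩)) :
    (r : ℝ) < KGd G (r - 1) := by
  obtain ⟨φ⟩ := hG
  obtain ⟨s, rfl⟩ : ∃ s, r = s + 1 := ⟨r - 1, by omega⟩
  have hs : 0 < s := by
    have h1 := hn ⟨s + 1 - 1, by omega⟩
    omega
  have hzero : (⟨0, hr⟩ : Fin (s + 1)) = 0 := rfl
  rw [hzero] at hpp
  -- two distinct primes dividing the smallest invariant
  obtain ⟨p, q, hp, hq, hpn, hqn, hpq⟩ : ∃ p q : ℕ, p.Prime ∧ q.Prime ∧ p ∣ n 0 ∧ q ∣ n 0 ∧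
      p ≠ q := by
    by_contra hcon
    push Not at hcon
    apply hpp
    rw [isPrimePow_iff_unique_prime_dvd]
    refine ⟨(n 0).minFac, ⟨Nat.minFac_prime (hn 0).ne', Nat.minFac_dvd _⟩, ?_⟩
    rintro y ⟨hy, hyn⟩
    exact hcon y _ hy (Nat.minFac_prime (hn 0).ne') hyn (Nat.minFac_dvd _)
  let P : Bool → ℕ := fun b => if b then p else q
  have hPn : ∀ b, P b ∣ n 0 := by
    intro b; cases b <;> simp [P, hpn, hqn]
  let m : Option (Bool × Fin s) → ℕ := fun o => o.elim (n 0) (fun z => P z.1)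
  let y : Option (Bool × Fin s) → (∀ i : Fin (s + 1), ZMod (n i)) := fun o =>
    o.elim (Pi.single 0 1) (fun z => Pi.single z.2.succ ((n z.2.succ / P z.1 : ℕ) : ZMod _))
  have hy : ∀ c : Option (Bool × Fin s) → ℤ, ∑ i, c i • y i = 0 ↔ ∀ i, (m i : ℤ) ∣ c i := by
    intro c
    have hc0 : (∑ i, c i • y i) 0 = ((c none : ℤ) : ZMod (n 0)) := by
      rw [Finset.sum_apply, Fintype.sum_option]
      simp [y, Pi.single_apply]
    have hcs : ∀ k : Fin s, (∑ i, c i • y i) k.succ =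
        ((c (some (true, k)) * (n k.succ / p : ℕ) + c (some (false, k)) * (n k.succ / q : ℕ) : ℤ) :
          ZMod (n k.succ)) := by
      intro k
      have hz : ∀ b (l : Fin s), (c (some (b, l)) • y (some (b, l))) k.succ =
          if l = k then ((c (some (b, k)) * (n k.succ / P b : ℕ) : ℤ) : ZMod (n k.succ)) else 0 := by
        intro b l
        by_cases hl : l = k
        · subst hl
          simp [y, -Int.natCast_ediv]
        · have : k.succ ≠ l.succ := fun h => hl (Fin.succ_injective _ h).symm
          simp [y, hl, this]
      rw [Finset.sum_apply, Fintype.sum_option, Fintype.sum_prod_type]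
      simp only [hz, Fintype.sum_bool, Finset.sum_ite_eq', Finset.mem_univ, if_true]
      simp [y, P]
    have hpair : ∀ k : Fin s, (∑ i, c i • y i) k.succ = 0 ↔
        (p : ℤ) ∣ c (some (true, k)) ∧ (q : ℤ) ∣ c (some (false, k)) := by
      intro k
      have hk : n 0 ∣ n k.succ := hdvd 0 k.succ (Fin.zero_le _)
      have h1 := hn k.succ
      rw [hcs, ZMod.intCast_zmod_eq_zero_iff_dvd]
      exact dvd_pair _ _ _ (by omega) ((Nat.coprime_primes hp hq).2 hpq) (hpn.trans hk)
        (hqn.trans hk) _ _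
    constructor
    · intro h
      rintro (_ | ⟨b, k⟩)
      · have := congrFun h 0
        rw [hc0] at this
        exact (ZMod.intCast_zmod_eq_zero_iff_dvd _ _).1 this
      · have := (hpair k).1 (congrFun h k.succ)
        cases b
        · simpa [m, P] using this.2
        · simpa [m, P] using this.1
    · intro h
      funext j
      refine Fin.cases ?_ (fun k => ?_) j
      · rw [hc0]
        exact (ZMod.intCast_zmod_eq_zero_iff_dvd _ _).2 (h none)
      · refine (hpair k).2 ⟨?_, ?_⟩
        · simpa [m, P] using h (some (true, k))
        · simpa [m, P] using h (some (false, k))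
  refine core_s12 s hs (n 0) P hPn ?_ ?_ (by have := hn 0; omega) m rfl (fun _ _ => rfl)
    (fun i => φ.symm (y i)) ?_
  · intro b; cases b
    · simpa [P] using hq.two_le
    · simpa [P] using hp.two_le
  · simpa [P] using hpq
  · intro c
    rw [← hy c, ← map_eq_zero_iff φ.symm φ.symm.injective, map_sum]
    simp only [map_zsmul]
end
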